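/- (Mean-zero functions on circles are angular derivatives.) Let J̃ be a smooth function on the closed disc D_R = {x²+ξ² ≤ 2R} ⊂ ℝ² such that for every 0 ≤ a ≤ R, the integral of J̃ − 1 over the disc {(x²+ξ²)/2 ≤ a} vanishes. Then, in polar coordinates (r,φ), there exists a smooth function ψ on D_R with J̃ = 1 + ∂_φψ; ψ may be chosen so that its integral over each circle centered at the origin is zero, and with this normalization ψ is unique and smooth including at the origin. -/

import Mathlib

open Set MeasureTheory

/-- The closed disc `{x² + ξ² ≤ 2R}` in `ℝ²`. -/
def discR (R : ℝ) : Set (ℝ × ℝ) := {z : ℝ × ℝ | z.1^2 + z.2^2 ≤ 2*R}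

open Filter Topology

theorem slice_cont {E G : Type} [NormedAddCommGroup E]
    [NormedAddCommGroup G] {K : Set E}
    {F : ℝ × E → G} (hF : ContinuousOn F (univ ×ˢ K)) {x : E} (hx : x ∈ K) :
    Continuous fun t => F (t, x) := by
  rw [← continuousOn_univ]
  exact hF.comp (by fun_prop) (fun t _ => ⟨mem_univ _, hx⟩)

theorem par_cont {E G : Type} [NormedAddCommGroup E]
    [NormedAddCommGroup G] [NormedSpace ℝ G] {K : Set E} (hK : IsCompact K) (a b : ℝ)
    {F : ℝ × E → G} (hF : ContinuousOn F (univ ×ˢ K)) :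
    ContinuousOn (fun x => ∫ t in a..b, F (t, x)) K := by
  obtain ⟨C, hC⟩ := ((isCompact_uIcc (a := a) (b := b)).prod hK).exists_bound_of_continuousOn
    (hF.mono (prod_mono_left (subset_univ _)))
  intro x hx
  refine intervalIntegral.continuousWithinAt_of_dominated_interval (bound := fun _ => C) ?_ ?_ (by simp) ?_
  · filter_upwards [self_mem_nhdsWithin] with y hy
    exact (slice_cont hF hy).aestronglyMeasurable
  · filter_upwards [self_mem_nhdsWithin] with y hy
    exact Eventually.of_forall fun t ht => hC (t, y) ⟨uIoc_subset_uIcc ht, hy⟩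
  · refine Eventually.of_forall fun t _ => ?_
    exact (hF.comp (f := fun y => (t, y)) (s := K) (by fun_prop) (fun y hy => ⟨mem_univ _, hy⟩)) x hx

theorem par_deriv {E G : Type} [NormedAddCommGroup E] [NormedSpace ℝ E]
    [NormedAddCommGroup G] [NormedSpace ℝ G] [CompleteSpace G]
    {K : Set E} (hK : IsCompact K) (hc : Convex ℝ K) (a b : ℝ)
    {F : ℝ × E → G} {F' : ℝ × E → E →L[ℝ] G} (hF : ContinuousOn F (univ ×ˢ K))
    (hF' : ContinuousOn F' (univ ×ˢ K))
    (hd : ∀ t, ∀ x ∈ K, HasFDerivWithinAt (fun y => F (t, y)) (F' (t, x)) K x) {x : E} (hx : x ∈ K) :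
    HasFDerivWithinAt (fun x => ∫ t in a..b, F (t, x)) (∫ t in a..b, F' (t, x)) K x := by
  obtain ⟨C, hC⟩ := ((isCompact_uIcc (a := a) (b := b)).prod hK).exists_bound_of_continuousOn
    (hF'.mono (prod_mono_left (subset_univ _)))
  rw [hasFDerivWithinAt_iff_tendsto]
  set Q : E → ℝ → G := fun y t => ‖y - x‖⁻¹ • (F (t, y) - F (t, x) - F' (t, x) (y - x)) with hQ
  have hFx := slice_cont hF hx
  have hF'x := slice_cont hF' hx
  have key : Tendsto (fun y => ∫ t in a..b, Q y t) (𝓝[K] x) (𝓝 (∫ t in a..b, (0 : G))) := by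
    refine intervalIntegral.tendsto_integral_filter_of_dominated_convergence (fun _ => 2 * C)
      ?_ ?_ (by simp) ?_
    · filter_upwards [self_mem_nhdsWithin] with y hy
      have := slice_cont hF hy
      have : Continuous (Q y) := 
        ((this.sub hFx).sub (hF'x.clm_apply continuous_const)).const_smul _
      exact this.aestronglyMeasurable
    · filter_upwards [self_mem_nhdsWithin] with y hy
      refine Eventually.of_forall fun t ht => ?_
      have ht' := uIoc_subset_uIcc ht
      have h1 := hc.norm_image_sub_le_of_norm_hasFDerivWithin_le' (f := fun y => F (t, y))
        (f' := fun y => F' (t, y)) (φ := F' (t, x)) (C := 2 * C) (fun z hz => hd t z hz)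
        (fun z hz => by
          have h1 := hC (t, z) ⟨ht', hz⟩
          have h2 := hC (t, x) ⟨ht', hx⟩
          have h3 := norm_sub_le (F' (t, z)) (F' (t, x))
          linarith) hx hy
      have hC0 : 0 ≤ 2 * C := by
        have h2 := (norm_nonneg _).trans (hC (t, x) ⟨ht', hx⟩)
        linarith
      simp only [hQ, norm_smul, norm_inv, norm_norm]
      rcases eq_or_ne (‖y - x‖) 0 with h0 | h0
      · simp [h0, hC0]
      · have hp : 0 < ‖y - x‖ := lt_of_le_of_ne (norm_nonneg _) h0.symm
        rw [inv_mul_le_iff₀ hp, mul_comm]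
        exact h1
    · refine Eventually.of_forall fun t _ => ?_
      have := (hasFDerivWithinAt_iff_tendsto.1 (hd t x hx))
      rw [tendsto_zero_iff_norm_tendsto_zero]
      refine this.congr fun y => ?_
      simp [hQ, norm_smul]
  rw [intervalIntegral.integral_zero, tendsto_zero_iff_norm_tendsto_zero] at key
  refine key.congr' ?_
  filter_upwards [self_mem_nhdsWithin] with y hy
  have hFy := slice_cont hF hy
  simp only [hQ]
  rw [intervalIntegral.integral_smul, norm_smul, norm_inv, norm_norm,
    intervalIntegral.integral_sub (f := fun t => F (t, y) - F (t, x))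
      (g := fun t => F' (t, x) (y - x)) ((hFy.sub hFx).intervalIntegrable _ _)
      ((hF'x.clm_apply continuous_const).intervalIntegrable _ _),
    intervalIntegral.integral_sub (hFy.intervalIntegrable _ _) (hFx.intervalIntegrable _ _),
    ← ContinuousLinearMap.intervalIntegral_apply (hF'x.intervalIntegrable _ _)]

theorem par_contDiff_nat (n : ℕ) {E : Type} [NormedAddCommGroup E] [NormedSpace ℝ E]
    {K : Set E} (hK : IsCompact K) (hc : Convex ℝ K) (hu : UniqueDiffOn ℝ K) (a b : ℝ) :
    ∀ {G : Type} [NormedAddCommGroup G] [NormedSpace ℝ G] [CompleteSpace G]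
    {F : ℝ × E → G}, ContDiffOn ℝ n F (univ ×ˢ K) →
    ContDiffOn ℝ n (fun x => ∫ t in a..b, F (t, x)) K := by
  induction n with
  | zero =>
    intro G _ _ _ F hF
    simp only [Nat.cast_zero, contDiffOn_zero] at *
    exact par_cont hK a b hF
  | succ n ih =>
    intro G _ _ _ F hF
    have hcF := hF.continuousOn
    have hu2 : UniqueDiffOn ℝ ((univ : Set ℝ) ×ˢ K) := uniqueDiffOn_univ.prod hu
    push_cast at *
    rw [contDiffOn_succ_iff_hasFDerivWithinAt_of_uniqueDiffOn hu2] at hF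
    obtain ⟨-, f', hf', hd⟩ := hF
    rw [contDiffOn_succ_iff_hasFDerivWithinAt_of_uniqueDiffOn hu]
    have h2 : ContDiffOn ℝ n (fun p => (f' p).comp (ContinuousLinearMap.inr ℝ ℝ E)) (univ ×ˢ K) :=
      hf'.clm_comp contDiffOn_const
    refine ⟨by simp, _, ih h2, fun x hx => ?_⟩
    refine par_deriv hK hc a b hcF h2.continuousOn (fun t y hy => ?_) hx
    exact (hd (t, y) ⟨mem_univ _, hy⟩).comp y (hasFDerivAt_prodMk_right t y).hasFDerivWithinAt
      (fun z hz => ⟨mem_univ _, hz⟩)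

theorem par_contDiff {E : Type} [NormedAddCommGroup E] [NormedSpace ℝ E]
    {K : Set E} (hK : IsCompact K) (hc : Convex ℝ K) (hu : UniqueDiffOn ℝ K) (a b : ℝ)
    {G : Type} [NormedAddCommGroup G] [NormedSpace ℝ G] [CompleteSpace G]
    {F : ℝ × E → G} (hF : ContDiffOn ℝ (⊤ : ℕ∞) F (univ ×ˢ K)) :
    ContDiffOn ℝ (⊤ : ℕ∞) (fun x => ∫ t in a..b, F (t, x)) K := by
  rw [contDiffOn_infty] at *
  exact fun n => par_contDiff_nat n hK hc hu a b (hF n)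

theorem disc_closed (R : ℝ) : IsClosed (discR R) := by
  unfold discR
  exact isClosed_le (by fun_prop) continuous_const

theorem disc_compact (R : ℝ) : IsCompact (discR R) := by
  refine Metric.isCompact_of_isClosed_isBounded (disc_closed R) ?_
  refine (Metric.isBounded_closedBall (x := (0 : ℝ × ℝ)) (r := 2 * R + 1)).subset ?_
  rintro ⟨x, y⟩ h
  simp only [discR, mem_ofPred_eq] at h
  simp only [Metric.mem_closedBall, dist_zero_right, Prod.norm_def, Real.norm_eq_abs, sup_le_iff]
  constructor <;> rw [abs_le] <;> constructor <;>
    nlinarith [sq_nonneg (x - 1), sq_nonneg (x + 1), sq_nonneg (y - 1), sq_nonneg (y + 1), sq_nonneg x, sq_nonneg y]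

theorem disc_convex (R : ℝ) : Convex ℝ (discR R) := by
  rintro ⟨x, y⟩ h ⟨x', y'⟩ h' a b ha hb hab
  simp only [discR, mem_ofPred_eq, Prod.smul_mk, Prod.mk_add_mk, smul_eq_mul] at *
  obtain rfl : b = 1 - a := by linarith
  nlinarith [mul_nonneg ha hb, mul_nonneg (mul_nonneg ha hb) (sq_nonneg (x - x')),
    mul_nonneg (mul_nonneg ha hb) (sq_nonneg (y - y')), mul_le_mul_of_nonneg_left h ha,
    mul_le_mul_of_nonneg_left h' hb]

theorem disc_uniq {R : ℝ} (hR : 0 < R) : UniqueDiffOn ℝ (discR R) := by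
  refine uniqueDiffOn_convex (disc_convex R) ⟨(0, 0), ?_⟩
  have ho : IsOpen {z : ℝ × ℝ | z.1^2 + z.2^2 < 2*R} := isOpen_lt (by fun_prop) continuous_const
  have hsub : {z : ℝ × ℝ | z.1^2 + z.2^2 < 2*R} ⊆ discR R := by
    intro z hz
    simp only [discR, mem_ofPred_eq] at *
    exact hz.le
  refine interior_maximal hsub ho ?_
  simp [hR]

/-- rotation by the angle `t` -/
noncomputable def rotz (t : ℝ) (z : ℝ × ℝ) : ℝ × ℝ :=
  (Real.cos t * z.1 - Real.sin t * z.2, Real.sin t * z.1 + Real.cos t * z.2)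

theorem rotz_mem {R : ℝ} (t : ℝ) {z : ℝ × ℝ} (hz : z ∈ discR R) : rotz t z ∈ discR R := by
  simp only [discR, rotz, mem_ofPred_eq] at *
  have := Real.sin_sq_add_cos_sq t
  have e : (Real.cos t * z.1 - Real.sin t * z.2) ^ 2 + (Real.sin t * z.1 + Real.cos t * z.2) ^ 2
    = (Real.sin t ^ 2 + Real.cos t ^ 2) * (z.1 ^ 2 + z.2 ^ 2) := by ring
  rw [e, this, one_mul]; exact hz

theorem rotz_rotz (s t : ℝ) (z : ℝ × ℝ) : rotz s (rotz t z) = rotz (s + t) z := by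
  simp only [rotz, Real.cos_add, Real.sin_add]
  ext <;> simp <;> ring

theorem rotz_zero (z : ℝ × ℝ) : rotz 0 z = z := by simp [rotz]

theorem rotz_two_pi (t : ℝ) (z : ℝ × ℝ) : rotz (t + 2 * Real.pi) z = rotz t z := by simp [rotz]

theorem rotz_axis (t r : ℝ) : rotz t (r, 0) = (r * Real.cos t, r * Real.sin t) := by
  simp [rotz, mul_comm]

theorem rotz_cont (z : ℝ × ℝ) : Continuous fun t => rotz t z := by
  unfold rotz; fun_prop

theorem rotz_deriv (z : ℝ × ℝ) (s : ℝ) :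
    HasDerivAt (fun t => rotz t z) (-(rotz s z).2, (rotz s z).1) s := by
  unfold rotz
  have h1 := ((Real.hasDerivAt_cos s).mul_const z.1).sub ((Real.hasDerivAt_sin s).mul_const z.2)
  have h2 := ((Real.hasDerivAt_sin s).mul_const z.1).add ((Real.hasDerivAt_cos s).mul_const z.2)
  refine (h1.prodMk h2).congr_deriv ?_
  refine Prod.ext ?_ ?_ <;> simp only <;> ring

theorem exists_polar {R : ℝ} {z : ℝ × ℝ} (hz : z ∈ discR R) :
    ∃ r ∈ Icc (0:ℝ) (Real.sqrt (2*R)), ∃ α, z = rotz α (r, 0) := by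
  refine ⟨‖(⟨z.1, z.2⟩ : ℂ)‖, ⟨norm_nonneg _, ?_⟩, Complex.arg ⟨z.1, z.2⟩, ?_⟩
  · rw [Complex.norm_def]
    apply Real.sqrt_le_sqrt
    simp only [Complex.normSq_mk]
    simp only [discR, mem_ofPred_eq] at hz
    nlinarith
  · rw [rotz_axis, Complex.norm_mul_cos_arg, Complex.norm_mul_sin_arg]

theorem axis_mem {R r : ℝ} (hR : 0 < R) (hr : r ∈ Icc (0:ℝ) (Real.sqrt (2*R))) :
    (r, (0:ℝ)) ∈ discR R := by
  have h := (Real.le_sqrt hr.1 (by positivity)).1 hr.2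
  simp [discR, h]

theorem radial_zero {R : ℝ} (hR : 0 < R) {f : ℝ × ℝ → ℝ} (hf : ContinuousOn f (discR R))
    (hmean : ∀ a ∈ Icc (0:ℝ) R, ∫ z in {z : ℝ × ℝ | (z.1^2 + z.2^2)/2 ≤ a}, f z = 0)
    {ρ : ℝ} (hρ : ρ ∈ Icc (0:ℝ) (Real.sqrt (2*R))) :
    ∫ r in (0:ℝ)..ρ, ∫ φ in (-Real.pi)..Real.pi, r * f (rotz φ (r, 0)) = 0 := by
  have hρ2 := (Real.le_sqrt hρ.1 (by positivity)).1 hρ.2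
  have h0 := hmean (ρ ^ 2 / 2) ⟨by positivity, by linarith⟩
  have hmeas : MeasurableSet {z : ℝ × ℝ | (z.1^2 + z.2^2)/2 ≤ ρ ^ 2 / 2} :=
    (isClosed_le (by fun_prop) continuous_const).measurableSet
  rw [← integral_indicator hmeas, ← integral_comp_polarCoord_symm] at h0
  have hm2 : MeasurableSet {p : ℝ × ℝ | p.1 ≤ ρ} :=
    (isClosed_le (by fun_prop) continuous_const).measurableSet
  have e1 : ∫ p in polarCoord.target, p.1 • (indicator {z : ℝ × ℝ | (z.1^2 + z.2^2)/2 ≤ ρ ^ 2 / 2} f)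
      (polarCoord.symm p) = ∫ p in polarCoord.target, indicator {p : ℝ × ℝ | p.1 ≤ ρ}
        (fun p => p.1 * f (rotz p.2 (p.1, 0))) p := by
    refine setIntegral_congr_fun polarCoord.open_target.measurableSet ?_
    rintro ⟨r, φ⟩ hp
    have hr : 0 < r := hp.1
    have hh : (r * Real.cos φ) ^ 2 + (r * Real.sin φ) ^ 2 = r ^ 2 := by
      have := Real.sin_sq_add_cos_sq φ
      linear_combination r ^ 2 * this
    have hiff : ((r * Real.cos φ) ^ 2 + (r * Real.sin φ) ^ 2) / 2 ≤ ρ ^ 2 / 2 ↔ r ≤ ρ := by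
      rw [hh]
      constructor
      · intro h
        exact le_of_sq_le_sq (by linarith) hρ.1
      · intro h
        have := pow_le_pow_left₀ hr.le h 2
        linarith
    simp only [polarCoord_symm_apply, indicator, mem_ofPred_eq, hiff, rotz_axis, smul_eq_mul]
    split_ifs <;> simp
  rw [e1, setIntegral_indicator hm2] at h0
  have e2 : polarCoord.target ∩ {p : ℝ × ℝ | p.1 ≤ ρ} = Ioc 0 ρ ×ˢ Ioo (-Real.pi) Real.pi := by
    ext ⟨r, φ⟩
    simp only [polarCoord_target, mem_inter_iff, mem_prod, mem_Ioi, mem_Ioo, mem_Ioc, mem_ofPred_eq]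
    tauto
  have hint : IntegrableOn (fun p : ℝ × ℝ => p.1 * f (rotz p.2 (p.1, 0)))
      (Ioc 0 ρ ×ˢ Ioo (-Real.pi) Real.pi) (volume.prod volume) := by
    refine IntegrableOn.mono_set (t := Icc 0 ρ ×ˢ Icc (-Real.pi) Real.pi) ?_
      (prod_mono Ioc_subset_Icc_self Ioo_subset_Icc_self)
    refine ContinuousOn.integrableOn_compact (isCompact_Icc.prod isCompact_Icc) ?_
    have hrc : Continuous fun p : ℝ × ℝ => rotz p.2 (p.1, 0) := by unfold rotz; fun_prop
    refine continuousOn_fst.mul (hf.comp hrc.continuousOn ?_)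
    intro p hp
    exact rotz_mem _ (axis_mem hR ⟨hp.1.1, hp.1.2.trans hρ.2⟩)
  rw [e2, Measure.volume_eq_prod, setIntegral_prod _ hint] at h0
  rw [intervalIntegral.integral_of_le hρ.1]
  refine Eq.trans ?_ h0
  refine setIntegral_congr_fun measurableSet_Ioc fun r _ => ?_
  simp only
  rw [intervalIntegral.integral_of_le (by linarith [Real.pi_pos]), integral_Ioc_eq_integral_Ioo]

theorem circle_zero {R : ℝ} (hR : 0 < R) {f : ℝ × ℝ → ℝ} (hf : ContinuousOn f (discR R))
    (hmean : ∀ a ∈ Icc (0:ℝ) R, ∫ z in {z : ℝ × ℝ | (z.1^2 + z.2^2)/2 ≤ a}, f z = 0)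
    {z : ℝ × ℝ} (hz : z ∈ discR R) :
    ∫ φ in (0:ℝ)..(2 * Real.pi), f (rotz φ z) = 0 := by
  set ρ := Real.sqrt (2*R) with hρ
  have hρ0 : 0 < ρ := Real.sqrt_pos.2 (by positivity)
  set h : ℝ → ℝ := fun r => ∫ φ in (-Real.pi)..Real.pi, f (rotz φ (r, 0)) with hh
  have hc : ContinuousOn h (Icc 0 ρ) := by
    refine par_cont (F := fun p => f (rotz p.1 (p.2, 0))) isCompact_Icc _ _ ?_
    refine hf.comp (by unfold rotz; fun_prop) ?_
    intro p hp
    exact rotz_mem _ (axis_mem hR hp.2)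
  have hk : ContinuousOn (fun r => r * h r) (Icc 0 ρ) := continuousOn_id.mul hc
  have hi : ∀ s ∈ Icc 0 ρ, ∫ r in (0:ℝ)..s, r * h r = 0 := by
    intro s hs
    have := radial_zero hR hf hmean hs
    simp only [intervalIntegral.integral_const_mul] at this
    exact this
  have h1 : EqOn h (fun _ => 0) (Ioo 0 ρ) := by
    intro r hr
    have hn : Icc 0 ρ ∈ 𝓝 r := Icc_mem_nhds hr.1 hr.2
    have hd := intervalIntegral.integral_hasDerivAt_right (f := fun r => r * h r) (a := 0) (b := r)
      ((hk.mono (by rw [uIcc_of_le hr.1.le]; exact Icc_subset_Icc_right hr.2.le)).intervalIntegrable)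
      (hk.stronglyMeasurableAtFilter_nhdsWithin measurableSet_Icc r |>.filter_mono
        (by rw [nhdsWithin_eq_nhds.2 hn]))
      (hk.continuousAt hn)
    have hd0 : HasDerivAt (fun u => ∫ x in (0:ℝ)..u, x * h x) 0 r := by
      refine (hasDerivAt_const r (0:ℝ)).congr_of_eventuallyEq ?_
      filter_upwards [hn] with s hs using hi s hs
    have := hd.unique hd0
    simpa [hr.1.ne'] using this
  have h2 : EqOn h (fun _ => 0) (Icc 0 ρ) :=
    h1.of_subset_closure hc continuousOn_const Ioo_subset_Icc_self
      (by rw [closure_Ioo hρ0.ne])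
  obtain ⟨r, hr, α, rfl⟩ := exists_polar hz
  have h3 := h2 hr
  simp only [hh] at h3
  simp only [rotz_rotz]
  have hper : Function.Periodic (fun φ => f (rotz φ (r, 0))) (2 * Real.pi) := fun t => by
    simp only [rotz_two_pi]
  rw [intervalIntegral.integral_comp_add_right (fun φ => f (rotz φ (r, 0)))]
  have := hper.intervalIntegral_add_eq (0 + α) (-Real.pi)
  rw [show 2 * Real.pi + α = 0 + α + 2 * Real.pi by ring, this,
    show -Real.pi + 2 * Real.pi = Real.pi by ring, h3]

theorem ang_deriv {R : ℝ} {ψ : ℝ × ℝ → ℝ} (hψ : ContDiffOn ℝ (⊤ : ℕ∞) ψ (discR R))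
    {z : ℝ × ℝ} (hz : z ∈ discR R) (s : ℝ) :
    HasDerivAt (fun t => ψ (rotz t z))
      (fderivWithin ℝ ψ (discR R) (rotz s z) (-(rotz s z).2, (rotz s z).1)) s := by
  have h1 := ((hψ.differentiableOn (by simp)) _ (rotz_mem s hz)).hasFDerivWithinAt
  have h2 := h1.comp_hasDerivWithinAt (s := univ) s (rotz_deriv z s).hasDerivWithinAt
    (fun t _ => rotz_mem t hz)
  exact hasDerivWithinAt_univ.1 h2

theorem circ_formula {g : ℝ → ℝ} (hg : Continuous g) (hp : Function.Periodic g (2 * Real.pi))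
    (h0 : ∫ u in (0:ℝ)..(2*Real.pi), g u = 0) :
    HasDerivAt (fun s => ∫ t in (0:ℝ)..(2*Real.pi), t * g (t + s)) (2 * Real.pi * g 0) 0 := by
  have e : (fun s => ∫ t in (0:ℝ)..(2*Real.pi), t * g (t + s)) =
      fun s => (∫ u in (0:ℝ)..(2 * Real.pi + s), u * g u) - ∫ u in (0:ℝ)..s, u * g u := by
    ext s
    have e1 := intervalIntegral.integral_comp_add_right (a := 0) (b := 2 * Real.pi)
      (fun u => (u - s) * g u) s
    simp only [add_sub_cancel_right] at e1
    have e2 : ∫ u in (0 + s)..(2 * Real.pi + s), g u = 0 := by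
      have := hp.intervalIntegral_add_eq s 0
      rw [zero_add, add_comm _ s, this, zero_add, h0]
    have c1 : Continuous fun u => u * g u := by fun_prop
    rw [e1]
    simp only [sub_mul]
    rw [intervalIntegral.integral_sub (c1.intervalIntegrable _ _)
      ((hg.const_mul s).intervalIntegrable _ _), intervalIntegral.integral_const_mul, e2, mul_zero,
      sub_zero, zero_add, intervalIntegral.integral_interval_sub_left (c1.intervalIntegrable _ _)
      (c1.intervalIntegrable _ _)]
  rw [e]
  have c1 : Continuous fun u => u * g u := by fun_prop
  have d1 := (c1.integral_hasStrictDerivAt 0 (2 * Real.pi + 0)).hasDerivAt.comp_const_add (2 * Real.pi) 0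
  have d2 := (c1.integral_hasStrictDerivAt 0 0).hasDerivAt
  refine (d1.sub d2).congr_deriv ?_
  have := hp 0
  rw [zero_add] at this
  simp [this]

theorem stmt11 (R : ℝ) (hR : 0 < R) (J : ℝ × ℝ → ℝ)
    (hJ : ContDiffOn ℝ (⊤ : ℕ∞) J (discR R))
    -- the integral of `J − 1` over every sub-disc `{(x²+ξ²)/2 ≤ a}`, `0 ≤ a ≤ R`, vanishes:
    (hmean : ∀ a ∈ Icc (0:ℝ) R,
      ∫ z in {z : ℝ × ℝ | (z.1^2 + z.2^2)/2 ≤ a}, (J z - 1) = 0) :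
    -- then `J = 1 + ∂_φ ψ` with `∂_φ = x ∂_ξ − ξ ∂_x`, for a unique smooth `ψ`
    -- with zero mean on every circle centered at the origin:
    ∃ ψ : ℝ × ℝ → ℝ,
      ContDiffOn ℝ (⊤ : ℕ∞) ψ (discR R) ∧
      (∀ z ∈ discR R, J z = 1 + fderivWithin ℝ ψ (discR R) z (-z.2, z.1)) ∧
      (∀ r ∈ Icc (0:ℝ) (Real.sqrt (2*R)),
        ∫ φ in (0:ℝ)..(2*Real.pi), ψ (r * Real.cos φ, r * Real.sin φ) = 0) ∧
      ∀ ψ' : ℝ × ℝ → ℝ,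
        ContDiffOn ℝ (⊤ : ℕ∞) ψ' (discR R) →
        (∀ z ∈ discR R, J z = 1 + fderivWithin ℝ ψ' (discR R) z (-z.2, z.1)) →
        (∀ r ∈ Icc (0:ℝ) (Real.sqrt (2*R)),
          ∫ φ in (0:ℝ)..(2*Real.pi), ψ' (r * Real.cos φ, r * Real.sin φ) = 0) →
        EqOn ψ' ψ (discR R) := by
  have hpi := Real.pi_pos
  set f : ℝ × ℝ → ℝ := fun z => J z - 1 with hf
  have hfs : ContDiffOn ℝ (⊤ : ℕ∞) f (discR R) := hJ.sub contDiffOn_const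
  have hz0 : ∀ z ∈ discR R, ∫ φ in (0:ℝ)..(2 * Real.pi), f (rotz φ z) = 0 :=
    fun z hz => circle_zero hR hfs.continuousOn hmean hz
  have hrs : ContDiff ℝ (⊤ : ℕ∞) (fun p : ℝ × ℝ × ℝ => rotz p.1 p.2) := by
    unfold rotz; fun_prop
  have hFs : ContDiffOn ℝ (⊤ : ℕ∞) (fun p : ℝ × ℝ × ℝ => p.1 * f (rotz p.1 p.2))
      (univ ×ˢ discR R) :=
    contDiff_fst.contDiffOn.mul (hfs.comp hrs.contDiffOn (fun p hp => rotz_mem _ hp.2))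
  have hgc : ∀ z ∈ discR R, Continuous fun t => f (rotz t z) := fun z hz => by
    rw [← continuousOn_univ]
    exact hfs.continuousOn.comp (rotz_cont z).continuousOn (fun t _ => rotz_mem t hz)
  set ψ : ℝ × ℝ → ℝ := fun z => (2 * Real.pi)⁻¹ * ∫ t in (0:ℝ)..(2 * Real.pi), t * f (rotz t z)
    with hψ
  have hψs : ContDiffOn ℝ (⊤ : ℕ∞) ψ (discR R) :=
    contDiffOn_const.mul (par_contDiff (disc_compact R) (disc_convex R) (disc_uniq hR) _ _ hFs)
  have hψd : ∀ z ∈ discR R, J z = 1 + fderivWithin ℝ ψ (discR R) z (-z.2, z.1) := by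
    intro z hz
    have h1 := ang_deriv hψs hz 0
    rw [rotz_zero] at h1
    have h2 := (circ_formula (hgc z hz) (fun t => by simp only [rotz_two_pi]) (hz0 z hz)).const_mul
      (2 * Real.pi)⁻¹
    simp only [hψ, rotz_rotz] at h1
    have h3 := h1.unique h2
    rw [← hψ] at h3
    rw [h3, rotz_zero, inv_mul_cancel_left₀ (by positivity)]
    simp [hf]
  have hψm : ∀ r ∈ Icc (0:ℝ) (Real.sqrt (2*R)),
      ∫ φ in (0:ℝ)..(2*Real.pi), ψ (r * Real.cos φ, r * Real.sin φ) = 0 := by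
    intro r hr
    have hz := axis_mem hR hr
    simp only [← rotz_axis, hψ, intervalIntegral.integral_const_mul]
    rw [intervalIntegral_intervalIntegral_swap]
    · have : ∀ t, ∫ φ in (0:ℝ)..(2*Real.pi), t * f (rotz t (rotz φ (r, 0))) = 0 := by
        intro t
        rw [intervalIntegral.integral_const_mul]
        have := hz0 _ (rotz_mem t hz)
        simp only [rotz_rotz] at *
        simp only [add_comm t]
        rw [this, mul_zero]
      simp only [this, intervalIntegral.integral_zero, mul_zero]
    · refine IntegrableOn.mono_set (t := uIcc 0 (2 * Real.pi) ×ˢ uIcc 0 (2 * Real.pi)) ?_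
        (prod_mono uIoc_subset_uIcc uIoc_subset_uIcc)
      refine ContinuousOn.integrableOn_compact (isCompact_uIcc.prod isCompact_uIcc) ?_
      have : Continuous fun p : ℝ × ℝ => p.2 * f (rotz (p.2 + p.1) (r, 0)) :=
        continuous_snd.mul ((hgc _ hz).comp (by fun_prop))
      refine this.continuousOn.congr fun p _ => ?_
      simp [Function.uncurry, rotz_rotz]
  refine ⟨ψ, hψs, hψd, hψm, ?_⟩
  · intro ψ' hs' hd' hm' z hz
    obtain ⟨r, hr, α, rfl⟩ := exists_polar hz
    have hz' := axis_mem hR hr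
    have hD : ∀ s, HasDerivAt (fun t => ψ' (rotz t (r, 0)) - ψ (rotz t (r, 0))) 0 s := by
      intro s
      have hm := rotz_mem s hz'
      refine ((ang_deriv hs' hz' s).sub (ang_deriv hψs hz' s)).congr_deriv ?_
      linarith [hd' _ hm, hψd _ hm]
    have hconst := is_const_of_deriv_eq_zero (fun s => (hD s).differentiableAt)
      (fun s => (hD s).deriv)
    have hc1 : ∀ χ : ℝ × ℝ → ℝ, ContDiffOn ℝ (⊤ : ℕ∞) χ (discR R) →
        Continuous fun t => χ (rotz t (r, 0)) := fun χ hχ =>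
      continuous_iff_continuousAt.2 fun s => (ang_deriv hχ hz' s).continuousAt
    have hI : ∫ φ in (0:ℝ)..(2*Real.pi), (ψ' (rotz φ (r, 0)) - ψ (rotz φ (r, 0))) = 0 := by
      rw [intervalIntegral.integral_sub ((hc1 _ hs').intervalIntegrable _ _)
        ((hc1 _ hψs).intervalIntegrable _ _)]
      simp only [rotz_axis]
      rw [hm' r hr, hψm r hr, sub_zero]
    rw [intervalIntegral.integral_congr (g := fun _ => ψ' (rotz α (r, 0)) - ψ (rotz α (r, 0)))
      (fun φ _ => hconst φ α), intervalIntegral.integral_const, smul_eq_mul, sub_zero] at hI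
    rcases mul_eq_zero.1 hI with h | h
    · linarith
    · linarith
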